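/- Suppose (A,B) is controllable, (A,C) is observable, L ≥ n, {u_k^d, y_k^d}_{k=0}^{N-1} is a trajectory of the LTI system, u^d is persistently exciting of order L + 2n, and {u_k, y_k}_{k=t-n}^{t-1} is the last n steps of some trajectory of the LTI system realized by a state sequence with state x_t ∈ ℝ^n at time t. Then the following data-driven optimal control problem is feasible: there exist α ∈ ℝ^{N−L−n+1} and {ū_k, ȳ_k}_{k=-n}^{L-1} such that (in stacked form) [ū; ȳ] = [H_{L+n}(u^d); H_{L+n}(y^d)]α, (ū_k, ȳ_k) = (u_k+t, y_k+t adjusted to the measured past, i.e., ū_k = u_{t+k} and ȳ_k = y_{t+k} for k = −n, …, −1), and (ū_k, ȳ_k) = (u^s, y^s) for k = L−n, …, L−1, if and only if there exists an input-output trajectory of the LTI system of length L + n that starts from the measured past window {u_k, y_k}_{k=t-n}^{t-1} and ends with n steps at the equilibrium (u^s, y^s). In particular, the data-dependent constraint set defined via the Hankel matrices coincides with the set of such system trajectories. -/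

import Mathlib

open Matrix

noncomputable section

/-- Hankel matrix of depth `L` of the sequence `u : {0,…,N-1} → ℝ^m`:
the block in block-row `i` and column `j` is `u (i+j)`. -/
def Hankel (m N L : ℕ) (u : ℕ → Fin m → ℝ) :
    Matrix (Fin L × Fin m) (Fin (N - L + 1)) ℝ :=
  Matrix.of fun ik j => u ((ik.1 : ℕ) + (j : ℕ)) ik.2

/-- The sequence `u` (of length `N`) is persistently exciting of order `L`. -/
def PersistentlyExciting (m N L : ℕ) (u : ℕ → Fin m → ℝ) : Prop :=
  (Hankel m N L u).rank = m * L

/-- `{u_k, y_k}_{k=0}^{L-1}` is a trajectory of the LTI system `(A,B,C,D)`. -/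
def IsTrajectory (n m p L : ℕ) (A : Matrix (Fin n) (Fin n) ℝ)
    (B : Matrix (Fin n) (Fin m) ℝ) (C : Matrix (Fin p) (Fin n) ℝ)
    (D : Matrix (Fin p) (Fin m) ℝ) (u : ℕ → Fin m → ℝ) (y : ℕ → Fin p → ℝ) : Prop :=
  ∃ x : ℕ → Fin n → ℝ, ∀ k < L,
    x (k + 1) = A.mulVec (x k) + B.mulVec (u k) ∧
    y k = C.mulVec (x k) + D.mulVec (u k)

/-- `(A,B)` is controllable: `rank [B, AB, …, A^{n-1}B] = n`. -/
def Controllable (n m : ℕ) (A : Matrix (Fin n) (Fin n) ℝ)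
    (B : Matrix (Fin n) (Fin m) ℝ) : Prop :=
  (Matrix.of fun i (kj : Fin n × Fin m) => ((A ^ (kj.1 : ℕ)) * B) i kj.2).rank = n

/-- `(A,C)` is observable: `rank [C; CA; …; CA^{n-1}] = n`. -/
def Observable (n p : ℕ) (A : Matrix (Fin n) (Fin n) ℝ)
    (C : Matrix (Fin p) (Fin n) ℝ) : Prop :=
  (Matrix.of fun (ki : Fin n × Fin p) j => (C * A ^ (ki.1 : ℕ)) ki.2 j).rank = n

/-- A matrix whose rank is its number of rows is onto as a linear map. -/
lemma mulVec_surjective_of_rank_eq_card {ι κ : Type*} [Fintype ι] [Fintype κ]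
    (M : Matrix ι κ ℝ) (h : M.rank = Fintype.card ι) : Function.Surjective M.mulVec := by
  have htop : LinearMap.range M.mulVecLin = ⊤ := by
    apply Submodule.eq_top_of_finrank_eq
    rw [Module.finrank_fintype_fun_eq_card, ← h, Matrix.rank]
  exact LinearMap.range_eq_top.mp htop

/-- A matrix whose rank is its number of rows has trivial left kernel. -/
lemma eq_zero_of_vecMul_eq_zero_of_rank_eq_card {ι κ : Type*} [Fintype ι] [Fintype κ]
    (M : Matrix ι κ ℝ) (h : M.rank = Fintype.card ι) (c : ι → ℝ) (hc : c ᵥ* M = 0) : c = 0 := by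
  refine dotProduct_eq_zero c fun w => ?_
  obtain ⟨v, rfl⟩ := mulVec_surjective_of_rank_eq_card M h w
  rw [dotProduct_mulVec, hc, zero_dotProduct]

/-- A matrix with trivial left kernel is onto as a linear map. -/
lemma mulVec_surjective_of_vecMul_eq_zero {ι κ : Type*} [Fintype ι] [Fintype κ]
    (M : Matrix ι κ ℝ) (h : ∀ c, c ᵥ* M = 0 → c = 0) : Function.Surjective M.mulVec := by
  apply mulVec_surjective_of_rank_eq_card
  apply LinearIndependent.rank_matrix
  rw [← Matrix.vecMul_injective_iff]
  intro c d hcd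
  refine sub_eq_zero.mp (h _ ?_)
  rw [sub_vecMul]
  exact sub_eq_zero.mpr hcd

lemma Controllable.eq_zero_of_forall_vecMul_eq_zero {n m : ℕ} {A : Matrix (Fin n) (Fin n) ℝ}
    {B : Matrix (Fin n) (Fin m) ℝ} (h : Controllable n m A B) (ξ : Fin n → ℝ)
    (hξ : ∀ i < n, ξ ᵥ* (A ^ i * B) = 0) : ξ = 0 := by
  refine eq_zero_of_vecMul_eq_zero_of_rank_eq_card _ (h.trans (Fintype.card_fin n).symm) ξ ?_
  ext ⟨k, a⟩
  exact congrFun (hξ k k.2) a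

lemma PersistentlyExciting.eq_zero_of_forall_sum_eq_zero {m N L : ℕ} {u : ℕ → Fin m → ℝ}
    (h : PersistentlyExciting m N L u) (hLN : L ≤ N) (c : ℕ → Fin m → ℝ)
    (hc : ∀ j, j + L ≤ N → ∑ i ∈ Finset.range L, c i ⬝ᵥ u (j + i) = 0) :
    ∀ i < L, c i = 0 := by
  have hz := eq_zero_of_vecMul_eq_zero_of_rank_eq_card (Hankel m N L u)
    (by rw [h, Fintype.card_prod, Fintype.card_fin, Fintype.card_fin, mul_comm])
    (fun ia => c ia.1 ia.2) (by
      ext j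
      have hj := hc j (by omega)
      rw [Finset.sum_range] at hj
      simpa [vecMul, dotProduct, Hankel, Fintype.sum_prod_type, add_comm] using hj)
  intro i hi
  ext a
  exact congrFun hz (⟨i, hi⟩, a)

/-- The input coefficients obtained by propagating the functional with state part `ξ` and input
part `η` forward by `k` steps of the dynamics `x⁺ = A x + B u`. -/
def propagate {n m : ℕ} (A : Matrix (Fin n) (Fin n) ℝ) (B : Matrix (Fin n) (Fin m) ℝ)
    (ξ : Fin n → ℝ) (η : ℕ → Fin m → ℝ) (k s : ℕ) : Fin m → ℝ :=
  if s < k then ξ ᵥ* (A ^ (k - 1 - s) * B) else η (s - k)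

/-- A functional annihilating all windows `(x j, u j, …, u (j + M - 1))` still annihilates,
after propagation by `k` steps, all windows `(x j, u j, …, u (j + M + k - 1))`. -/
lemma propagate_annihilates {n m : ℕ} {A : Matrix (Fin n) (Fin n) ℝ}
    {B : Matrix (Fin n) (Fin m) ℝ} {x : ℕ → Fin n → ℝ} {u : ℕ → Fin m → ℝ} {N M : ℕ}
    (hx : ∀ k < N, x (k + 1) = A *ᵥ x k + B *ᵥ u k) {ξ : Fin n → ℝ} {η : ℕ → Fin m → ℝ}
    (h : ∀ j, j + M ≤ N → ξ ⬝ᵥ x j + ∑ i ∈ Finset.range M, η i ⬝ᵥ u (j + i) = 0) (k : ℕ) :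
    ∀ j, j + (M + k) ≤ N → (ξ ᵥ* A ^ k) ⬝ᵥ x j +
      ∑ s ∈ Finset.range (M + k), propagate A B ξ η k s ⬝ᵥ u (j + s) = 0 := by
  induction k with
  | zero => simpa [propagate] using h
  | succ k ih =>
    intro j hj
    have hk := ih (j + 1) (by omega)
    rw [hx j (by omega), dotProduct_add, dotProduct_mulVec, dotProduct_mulVec, vecMul_vecMul,
      vecMul_vecMul, ← pow_succ] at hk
    rw [← add_assoc, Finset.sum_range_succ']
    have h0 : propagate A B ξ η (k + 1) 0 = ξ ᵥ* (A ^ k * B) := by simp [propagate]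
    have hs : ∀ s, propagate A B ξ η (k + 1) (s + 1) = propagate A B ξ η k s := by
      intro s
      simp only [propagate, add_lt_add_iff_right, Nat.add_sub_add_right]
      rw [show k + 1 - 1 - (s + 1) = k - 1 - s by omega]
    simp only [h0, hs, add_zero]
    simp only [add_assoc, add_comm 1] at hk ⊢
    linarith

/-- Under controllability and excitation of order `M + n`, no nonzero functional annihilates all
windows `(x j, u j, …, u (j + M - 1))` of the data. -/
lemma annihilator_eq_zero {n m : ℕ} {A : Matrix (Fin n) (Fin n) ℝ}
    {B : Matrix (Fin n) (Fin m) ℝ} {x : ℕ → Fin n → ℝ} {u : ℕ → Fin m → ℝ} {N M : ℕ}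
    (hctrb : Controllable n m A B) (hPE : PersistentlyExciting m N (M + n) u) (hMN : M + n ≤ N)
    (hx : ∀ k < N, x (k + 1) = A *ᵥ x k + B *ᵥ u k) {ξ : Fin n → ℝ} {η : ℕ → Fin m → ℝ}
    (hη : ∀ i, M ≤ i → η i = 0)
    (h : ∀ j, j + M ≤ N → ξ ⬝ᵥ x j + ∑ i ∈ Finset.range M, η i ⬝ᵥ u (j + i) = 0) :
    ξ = 0 ∧ ∀ i, η i = 0 := by
  set a : ℕ → ℝ := fun k => A.charpoly.coeff k
  have hdeg : A.charpoly.natDegree = n := by simp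
  have han : a n = 1 := by
    have hm := A.charpoly_monic.coeff_natDegree
    rwa [hdeg] at hm
  have hCH : ∑ k ∈ Finset.range (n + 1), a k • A ^ k = 0 := by
    have hA := A.aeval_self_charpoly
    rwa [Polynomial.aeval_eq_sum_range, hdeg] at hA
  have hV : ∀ s < M + n, ∑ k ∈ Finset.range (n + 1), a k • propagate A B ξ η k s = 0 := by
    refine hPE.eq_zero_of_forall_sum_eq_zero hMN _ fun j hj => ?_
    have hwin : ∀ k ∈ Finset.range (n + 1), a k * ((ξ ᵥ* A ^ k) ⬝ᵥ x j) +
        ∑ s ∈ Finset.range (M + n), a k * (propagate A B ξ η k s ⬝ᵥ u (j + s)) = 0 := by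
      intro k hk
      have hkn : k ≤ n := Finset.mem_range_succ_iff.mp hk
      rw [← Finset.mul_sum, ← mul_add]
      have hsub : ∑ s ∈ Finset.range (M + n), propagate A B ξ η k s ⬝ᵥ u (j + s) =
          ∑ s ∈ Finset.range (M + k), propagate A B ξ η k s ⬝ᵥ u (j + s) := by
        refine (Finset.sum_subset (Finset.range_mono (by omega)) fun s _ hs => ?_).symm
        rw [Finset.mem_range, not_lt] at hs
        rw [propagate, if_neg (by omega), hη _ (by omega), zero_dotProduct]
      rw [hsub, propagate_annihilates hx h k j (by omega), mul_zero]
    have hstate : ∑ k ∈ Finset.range (n + 1), a k * ((ξ ᵥ* A ^ k) ⬝ᵥ x j) = 0 := by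
      have hCH' := congrArg (fun P => ξ ⬝ᵥ (P *ᵥ x j)) hCH
      simpa [sum_mulVec, dotProduct_sum, smul_mulVec, dotProduct_mulVec] using hCH'
    have htot := Finset.sum_eq_zero hwin
    rw [Finset.sum_add_distrib, hstate, zero_add, Finset.sum_comm] at htot
    simpa [sum_dotProduct] using htot
  have hη0 : ∀ d i, M ≤ i + d → η i = 0 := by
    intro d
    induction d with
    | zero => simpa using hη
    | succ d ih =>
      intro i hi
      by_cases hiM : M ≤ i
      · exact hη i hiM
      have hs := hV (i + n) (by omega)
      rw [Finset.sum_range_succ, Finset.sum_eq_zero, han, zero_add, one_smul] at hs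
      · simpa [propagate] using hs
      · intro k hk
        rw [Finset.mem_range] at hk
        rw [propagate, if_neg (by omega), ih _ (by omega), smul_zero]
  have hη1 : ∀ i, η i = 0 := fun i => hη0 M i (by omega)
  refine ⟨hctrb.eq_zero_of_forall_vecMul_eq_zero ξ fun i => ?_, hη1⟩
  induction i using Nat.strong_induction_on with
  | _ i ih =>
    intro hi
    have hs := hV (n - 1 - i) (by omega)
    rw [Finset.sum_range_succ, Finset.sum_eq_zero, han, zero_add, one_smul, propagate,
      if_pos (by omega), show n - 1 - (n - 1 - i) = i by omega] at hs
    · exact hs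
    · intro k hk
      rw [Finset.mem_range] at hk
      rw [propagate]
      split_ifs with hk'
      · rw [ih _ (by omega) (by omega), smul_zero]
      · rw [hη1, smul_zero]

/-- Every initial state and input window of length `M` is a linear combination of the
corresponding windows of sufficiently exciting data. -/
lemma exists_data_combination {n m : ℕ} {A : Matrix (Fin n) (Fin n) ℝ}
    {B : Matrix (Fin n) (Fin m) ℝ} {x : ℕ → Fin n → ℝ} {u : ℕ → Fin m → ℝ} {N M : ℕ}
    (hctrb : Controllable n m A B) (hPE : PersistentlyExciting m N (M + n) u) (hMN : M + n ≤ N)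
    (hx : ∀ k < N, x (k + 1) = A *ᵥ x k + B *ᵥ u k) (x₀ : Fin n → ℝ) (v : ℕ → Fin m → ℝ) :
    ∃ α : Fin (N - M + 1) → ℝ,
      ∑ j, α j • x j = x₀ ∧ ∀ i < M, ∑ j, α j • u (i + j) = v i := by
  have hsurj := mulVec_surjective_of_vecMul_eq_zero
    (fromRows (Hankel m N M u) (Matrix.of fun i (j : Fin (N - M + 1)) => x j i)) (by
    intro c hc
    let ξ : Fin n → ℝ := fun i => c (Sum.inr i)
    let η : ℕ → Fin m → ℝ := fun i a => if hi : i < M then c (Sum.inl (⟨i, hi⟩, a)) else 0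
    have hz : ξ = 0 ∧ ∀ i, η i = 0 := by
      refine annihilator_eq_zero hctrb hPE hMN hx (fun i hi => ?_) (fun j hj => ?_)
      · ext a
        simp [η, not_lt.mpr hi]
      · have hcj := congrFun hc ⟨j, by omega⟩
        rw [Finset.sum_range]
        simpa [vecMul, dotProduct, Hankel, Fintype.sum_prod_type, add_comm, ξ, η] using hcj
    ext (⟨i, a⟩ | i)
    · simpa [η] using congrFun (hz.2 i) a
    · exact congrFun hz.1 i)
  obtain ⟨α, hα⟩ := hsurj (Sum.elim (fun ia => v ia.1 ia.2) x₀)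
  rw [fromRows_mulVec] at hα
  refine ⟨α, ?_, fun i hi => ?_⟩
  · ext i
    simpa [mulVec, dotProduct, mul_comm] using congrFun hα (Sum.inr i)
  · ext a
    simpa [mulVec, dotProduct, mul_comm, Hankel] using congrFun hα (Sum.inl (⟨i, hi⟩, a))

lemma hankel_mulVec_apply {m N L : ℕ} (u : ℕ → Fin m → ℝ) (α : Fin (N - L + 1) → ℝ)
    (k : Fin L) (a : Fin m) :
    (Hankel m N L u *ᵥ α) (k, a) = (∑ j, α j • u (k + j)) a := by
  simp [mulVec, dotProduct, Hankel, mul_comm]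

/-- A linear combination of shifted windows of a trajectory satisfies the system equations. -/
lemma data_combination_step {n m p N M : ℕ} {A : Matrix (Fin n) (Fin n) ℝ}
    {B : Matrix (Fin n) (Fin m) ℝ} {C : Matrix (Fin p) (Fin n) ℝ} {D : Matrix (Fin p) (Fin m) ℝ}
    {x : ℕ → Fin n → ℝ} {u : ℕ → Fin m → ℝ} {y : ℕ → Fin p → ℝ} (hMN : M ≤ N)
    (hx : ∀ k < N, x (k + 1) = A *ᵥ x k + B *ᵥ u k ∧ y k = C *ᵥ x k + D *ᵥ u k)
    (α : Fin (N - M + 1) → ℝ) (k : ℕ) (hk : k < M) :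
    ∑ j, α j • x (k + 1 + j) = A *ᵥ ∑ j, α j • x (k + j) + B *ᵥ ∑ j, α j • u (k + j) ∧
    ∑ j, α j • y (k + j) = C *ᵥ ∑ j, α j • x (k + j) + D *ᵥ ∑ j, α j • u (k + j) := by
  simp only [mulVec_sum, mulVec_smul, ← Finset.sum_add_distrib, ← smul_add]
  constructor <;> refine Finset.sum_congr rfl fun j _ => ?_
  · rw [add_right_comm, (hx (k + j) (by omega)).1]
  · rw [(hx (k + j) (by omega)).2]

/-- Feasibility of the data-driven MPC optimal control problem: the constraint set
defined via the Hankel matrices of the data (with initial conditions given by the past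
`n` measurements and terminal equality constraints at the equilibrium `(u^s, y^s)`)
coincides with the set of system trajectories of length `L + n` starting from the
measured past window and ending with `n` steps at the equilibrium. -/
theorem data_driven_ocp_feasibility (n m p N L t : ℕ)
    (A : Matrix (Fin n) (Fin n) ℝ) (B : Matrix (Fin n) (Fin m) ℝ)
    (C : Matrix (Fin p) (Fin n) ℝ) (D : Matrix (Fin p) (Fin m) ℝ)
    (hctrb : Controllable n m A B) (hobs : Observable n p A C)
    (hL : n ≤ L) (hL1 : 1 ≤ L) (hLN : L + 2 * n ≤ N) (htn : n ≤ t)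
    (ud : ℕ → Fin m → ℝ) (yd : ℕ → Fin p → ℝ)
    (hT : IsTrajectory n m p N A B C D ud yd)
    (hPE : PersistentlyExciting m N (L + 2 * n) ud)
    (us : Fin m → ℝ) (ys : Fin p → ℝ)
    (heq : IsTrajectory n m p (n + 1) A B C D (fun _ => us) (fun _ => ys))
    (u : ℕ → Fin m → ℝ) (y : ℕ → Fin p → ℝ) (xt : Fin n → ℝ)
    (hpast : ∃ x : ℕ → Fin n → ℝ, x t = xt ∧ ∀ k < t,
      x (k + 1) = A.mulVec (x k) + B.mulVec (u k) ∧
      y k = C.mulVec (x k) + D.mulVec (u k)) :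
    (∃ (α : Fin (N - (L + n) + 1) → ℝ) (ub : ℕ → Fin m → ℝ) (yb : ℕ → Fin p → ℝ),
      (∀ (k : Fin (L + n)) (a : Fin m),
        ub k a = (Hankel m N (L + n) ud).mulVec α (k, a)) ∧
      (∀ (k : Fin (L + n)) (b : Fin p),
        yb k b = (Hankel p N (L + n) yd).mulVec α (k, b)) ∧
      (∀ k < n, ub k = u (t - n + k) ∧ yb k = y (t - n + k)) ∧
      (∀ k, L ≤ k → k < L + n → ub k = us ∧ yb k = ys))
    ↔
    (∃ (ub : ℕ → Fin m → ℝ) (yb : ℕ → Fin p → ℝ),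
      IsTrajectory n m p (L + n) A B C D ub yb ∧
      (∀ k < n, ub k = u (t - n + k) ∧ yb k = y (t - n + k)) ∧
      (∀ k, L ≤ k → k < L + n → ub k = us ∧ yb k = ys)) := by
  obtain ⟨x, hx⟩ := hT
  have hMN : L + n ≤ N := by omega
  constructor
  · rintro ⟨α, ub, yb, hu, hy, hini, hend⟩
    refine ⟨ub, yb, ⟨fun k => ∑ j, α j • x (k + j), fun k hk => ?_⟩, hini, hend⟩
    have huk : ub k = ∑ j, α j • ud (k + j) :=
      funext fun a => (hu ⟨k, hk⟩ a).trans (hankel_mulVec_apply ud α ⟨k, hk⟩ a)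
    have hyk : yb k = ∑ j, α j • yd (k + j) :=
      funext fun b => (hy ⟨k, hk⟩ b).trans (hankel_mulVec_apply yd α ⟨k, hk⟩ b)
    rw [huk, hyk]
    exact data_combination_step hMN hx α k hk
  · rintro ⟨ub, yb, ⟨xb, hxb⟩, hini, hend⟩
    rw [two_mul, ← add_assoc] at hPE
    obtain ⟨α, hα0, hαu⟩ := exists_data_combination hctrb hPE (by omega)
      (fun k hk => (hx k hk).1) (xb 0) ub
    have hstate : ∀ k ≤ L + n, ∑ j, α j • x (k + j) = xb k := by
      intro k
      induction k with
      | zero => simpa using hα0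
      | succ k ih =>
        intro hk
        rw [(data_combination_step hMN hx α k hk).1, ih (by omega), hαu k hk, (hxb k hk).1]
    refine ⟨α, ub, yb, fun k a => ?_, fun k b => ?_, hini, hend⟩
    · rw [hankel_mulVec_apply, hαu k k.2]
    · rw [hankel_mulVec_apply, (data_combination_step hMN hx α k k.2).2, hstate k k.2.le,
        hαu k k.2, (hxb k k.2).2]
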